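/- arXiv:2010.12859 — 3 statements merged into one kernel-verified Lean document; each statement's English description precedes it below -/
import Mathlib

section
/- Let f : [−1,1] → ℝ be defined by f(γ) = (1/π)·(√(1−γ²) − γ·arccos γ). Then there exists a real sequence (α_n)_{n∈ℕ} with ∑_{n} |α_n| < ∞ such that f(γ) = ∑_{n≥0} α_n γ^n for all γ ∈ [−1,1], and moreover: α_n > 0 for every even n, α_1 = −1/2, and α_n = 0 for every odd n ≥ 3. -/
/-- The "residual" part of the ReLU dual kernel function. -/
noncomputable def resf (γ : ℝ) : ℝ :=
  (1 / Real.pi) * (Real.sqrt (1 - γ ^ 2) - γ * Real.arccos γ)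

open Set in
/-- Termwise differentiation of `∑ dₖ x ^ (2k+m+1) / (2k+m+1)` on `(-1,1)`. -/
theorem hasDerivAt_tsum_pow_of_abs_le_one {d : ℕ → ℝ} (hd : ∀ k, |d k| ≤ 1) (m : ℕ) {x : ℝ}
    (hx : x ∈ Ioo (-1 : ℝ) 1) :
    HasDerivAt (fun y => ∑' k : ℕ, d k / (2 * k + m + 1) * y ^ (2 * k + m + 1))
      (∑' k : ℕ, d k * x ^ (2 * k + m)) x := by
  obtain ⟨r, hxr, hr1⟩ := exists_between (abs_lt.2 hx)
  have hr0 : 0 < r := (abs_nonneg x).trans_lt hxr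
  have hr2 : r ^ 2 < 1 := pow_lt_one₀ hr0.le hr1 two_ne_zero
  refine hasDerivAt_tsum_of_isPreconnected
    (g := fun (k : ℕ) y => d k / (2 * k + m + 1) * y ^ (2 * k + m + 1))
    (g' := fun k y => d k * y ^ (2 * k + m)) (u := fun k => (r ^ 2) ^ k) (t := Ioo (-r) r) (y₀ := 0)
    (summable_geometric_of_lt_one (by positivity) hr2) isOpen_Ioo isPreconnected_Ioo
    ?_ ?_ ⟨by linarith, hr0⟩ ?_ (abs_lt.1 hxr)
  · intro k y _
    have h := (hasDerivAt_pow (2 * k + m + 1) y).const_mul (d k / (2 * k + m + 1))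
    have hne : (2 * (k : ℝ) + m + 1) ≠ 0 := by positivity
    refine h.congr_deriv ?_
    rw [← mul_assoc]
    push_cast
    rw [div_mul_cancel₀ _ hne]
  · intro k y hy
    have hy' : |y| ≤ r := (abs_lt.2 hy).le
    rw [Real.norm_eq_abs, abs_mul, abs_pow, ← pow_mul]
    calc |d k| * |y| ^ (2 * k + m) ≤ 1 * |y| ^ (2 * k) := by
          have hpow : |y| ^ (2 * k + m) ≤ |y| ^ (2 * k) :=
            pow_le_pow_of_le_one (abs_nonneg y) (hy'.trans hr1.le) (Nat.le_add_right _ _)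
          exact mul_le_mul (hd k) hpow (by positivity) zero_le_one
      _ ≤ r ^ (2 * k) := by rw [one_mul]; gcongr
  · simp

/-- The coefficients of `1 / √(1 - x) = ∑ cₖ xᵏ`. -/
noncomputable def invSqrtCoeff (k : ℕ) : ℝ := Ring.choose ((1 / 2 : ℝ) + k - 1) k

theorem factorial_mul_invSqrtCoeff (k : ℕ) :
    (k.factorial : ℝ) * invSqrtCoeff k = (ascPochhammer ℝ k).eval (1 / 2) := by
  rw [invSqrtCoeff, ← Ring.multichoose_eq, ← nsmul_eq_mul,
    Ring.factorial_nsmul_multichoose_eq_ascPochhammer, Polynomial.ascPochhammer_smeval_eq_eval]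

theorem invSqrtCoeff_pos (k : ℕ) : 0 < invSqrtCoeff k := by
  have h := ascPochhammer_pos k (1 / 2 : ℝ) (by norm_num)
  rw [← factorial_mul_invSqrtCoeff] at h
  exact pos_of_mul_pos_right h (by positivity)

theorem invSqrtCoeff_le_one (k : ℕ) : invSqrtCoeff k ≤ 1 := by
  have h : (ascPochhammer ℝ k).eval (1 / 2) ≤ (k.factorial : ℝ) := by
    induction k with
    | zero => simp
    | succ k ih =>
      rw [ascPochhammer_succ_eval, Nat.factorial_succ, mul_comm (k + 1)]
      push_cast
      exact mul_le_mul ih (by linarith) (by positivity) (by positivity)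
  rw [← factorial_mul_invSqrtCoeff] at h
  exact le_of_mul_le_mul_left (by simpa using h) (by positivity : (0 : ℝ) < k.factorial)

open Set in
theorem tsum_invSqrtCoeff {x : ℝ} (hx : x ∈ Ioo (-1 : ℝ) 1) :
    ∑' k : ℕ, invSqrtCoeff k * x ^ (2 * k) = 1 / √(1 - x ^ 2) := by
  have hx2 : x ^ 2 < 1 := (sq_lt_one_iff_abs_lt_one x).2 (abs_lt.2 hx)
  have h := (Real.one_div_one_sub_rpow_hasFPowerSeriesOnBall_zero (1 / 2)).hasSum
    (y := x ^ 2) (by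
      rw [Metric.mem_eball, edist_zero_right, Real.enorm_eq_ofReal (sq_nonneg x)]
      simpa using hx2)
  rw [Real.sqrt_eq_rpow]
  simpa [FormalMultilinearSeries.ofScalars_apply_eq, ← pow_mul, invSqrtCoeff, mul_comm (x ^ _)]
    using h.tsum_eq

open Set in
theorem tsum_arcsin {x : ℝ} (hx : x ∈ Ioo (-1 : ℝ) 1) :
    ∑' k : ℕ, invSqrtCoeff k / (2 * k + 1) * x ^ (2 * k + 1) = Real.arcsin x := by
  have hd : ∀ k, |invSqrtCoeff k| ≤ 1 := fun k => by
    rw [abs_of_pos (invSqrtCoeff_pos k)]; exact invSqrtCoeff_le_one k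
  have h1 : ∀ y ∈ Ioo (-1 : ℝ) 1, HasDerivAt
      (fun y => ∑' k : ℕ, invSqrtCoeff k / (2 * k + 1) * y ^ (2 * k + 1))
      (1 / √(1 - y ^ 2)) y := fun y hy => by
    simpa [tsum_invSqrtCoeff hy] using hasDerivAt_tsum_pow_of_abs_le_one hd 0 hy
  have h2 : ∀ y ∈ Ioo (-1 : ℝ) 1, HasDerivAt Real.arcsin (1 / √(1 - y ^ 2)) y :=
    fun y hy => Real.hasDerivAt_arcsin hy.1.ne' hy.2.ne
  exact isOpen_Ioo.eqOn_of_deriv_eq isPreconnected_Ioo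
    (fun y hy => (h1 y hy).differentiableAt.differentiableWithinAt)
    (fun y hy => (h2 y hy).differentiableAt.differentiableWithinAt)
    (fun y hy => (h1 y hy).deriv.trans (h2 y hy).deriv.symm)
    (show (0 : ℝ) ∈ Ioo (-1 : ℝ) 1 by norm_num) (by simp) hx

/-- The coefficients of `√(1 - x²) + x arcsin x - 1 = ∑ aₖ x ^ (2k+2)`. -/
noncomputable def evenCoeff (k : ℕ) : ℝ := invSqrtCoeff k / (2 * k + 1) / (2 * k + 2)

theorem evenCoeff_pos (k : ℕ) : 0 < evenCoeff k := by
  have := invSqrtCoeff_pos k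
  unfold evenCoeff
  positivity

theorem summable_evenCoeff : Summable evenCoeff := by
  have h : Summable fun k : ℕ => 1 / ((k + 1 : ℕ) : ℝ) ^ 2 :=
    (summable_nat_add_iff 1).2 (Real.summable_one_div_nat_pow.2 one_lt_two)
  refine Summable.of_nonneg_of_le (fun k => (evenCoeff_pos k).le) (fun k => ?_) h
  have hk : (0 : ℝ) ≤ k := k.cast_nonneg
  rw [evenCoeff, div_div]
  push_cast
  gcongr
  · exact invSqrtCoeff_le_one k
  · nlinarith

theorem norm_evenCoeff_mul_pow_le (k : ℕ) {x : ℝ} (hx : x ∈ Set.Icc (-1 : ℝ) 1) :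
    ‖evenCoeff k * x ^ (2 * k + 2)‖ ≤ evenCoeff k := by
  rw [norm_mul, norm_pow, Real.norm_of_nonneg (evenCoeff_pos k).le]
  exact mul_le_of_le_one_right (evenCoeff_pos k).le
    (pow_le_one₀ (norm_nonneg x) (abs_le.2 hx))

open Set in
theorem tsum_evenCoeff_of_mem_Ioo {x : ℝ} (hx : x ∈ Ioo (-1 : ℝ) 1) :
    ∑' k : ℕ, evenCoeff k * x ^ (2 * k + 2) = √(1 - x ^ 2) + x * Real.arcsin x - 1 := by
  have hd : ∀ k : ℕ, |invSqrtCoeff k / (2 * k + 1)| ≤ 1 := fun k => by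
    have := invSqrtCoeff_pos k
    rw [abs_of_pos (by positivity), div_le_one (by positivity)]
    have hk : (0 : ℝ) ≤ k := k.cast_nonneg
    linarith [invSqrtCoeff_le_one k]
  have h1 : ∀ y ∈ Ioo (-1 : ℝ) 1, HasDerivAt
      (fun y => ∑' k : ℕ, evenCoeff k * y ^ (2 * k + 2)) (Real.arcsin y) y := fun y hy => by
    have h := hasDerivAt_tsum_pow_of_abs_le_one hd 1 hy
    rw [tsum_arcsin hy] at h
    refine h.congr_deriv rfl |>.congr_of_eventuallyEq (.of_forall fun z => ?_)
    refine tsum_congr fun k => ?_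
    rw [evenCoeff]
    norm_num [add_assoc]
  have h2 : ∀ y ∈ Ioo (-1 : ℝ) 1, HasDerivAt
      (fun y => √(1 - y ^ 2) + y * Real.arcsin y - 1) (Real.arcsin y) y := fun y hy => by
    have hy2 : 0 < 1 - y ^ 2 := by nlinarith [hy.1, hy.2]
    have ha := Real.hasDerivAt_arcsin hy.1.ne' hy.2.ne
    have hs := (((hasDerivAt_id y).pow 2).const_sub 1).sqrt hy2.ne'
    refine ((hs.add ((hasDerivAt_id y).mul ha)).sub_const 1).congr_deriv ?_
    have := (Real.sqrt_pos.2 hy2).ne'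
    simp
    field_simp
    ring
  exact isOpen_Ioo.eqOn_of_deriv_eq isPreconnected_Ioo
    (fun y hy => (h1 y hy).differentiableAt.differentiableWithinAt)
    (fun y hy => (h2 y hy).differentiableAt.differentiableWithinAt)
    (fun y hy => (h1 y hy).deriv.trans (h2 y hy).deriv.symm)
    (show (0 : ℝ) ∈ Ioo (-1 : ℝ) 1 by norm_num) (by simp) hx

open Set in
theorem hasSum_evenCoeff {x : ℝ} (hx : x ∈ Icc (-1 : ℝ) 1) :
    HasSum (fun k : ℕ => evenCoeff k * x ^ (2 * k + 2))
      (√(1 - x ^ 2) + x * Real.arcsin x - 1) := by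
  have h : EqOn (fun y => ∑' k : ℕ, evenCoeff k * y ^ (2 * k + 2))
      (fun y => √(1 - y ^ 2) + y * Real.arcsin y - 1) (Icc (-1) 1) := by
    refine EqOn.of_subset_closure (s := Ioo (-1) 1) (fun y hy => tsum_evenCoeff_of_mem_Ioo hy)
      (continuousOn_tsum (fun k => by fun_prop) summable_evenCoeff
        fun k y hy => norm_evenCoeff_mul_pow_le k hy) ?_ Ioo_subset_Icc_self
      (closure_Ioo (by norm_num)).ge
    have := Real.continuous_arcsin
    fun_prop
  have hx' := h hx
  beta_reduce at hx'
  rw [← hx']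
  exact (Summable.of_norm_bounded summable_evenCoeff
    fun k => norm_evenCoeff_mul_pow_le k hx).hasSum

/-- The power-series coefficients of `resf`. -/
noncomputable def resfCoeff (n : ℕ) : ℝ :=
  if Even n then (if n = 0 then 1 else evenCoeff (n / 2 - 1)) / Real.pi
  else if n = 1 then -(1 / 2) else 0

theorem resfCoeff_zero : resfCoeff 0 = 1 / Real.pi := by simp [resfCoeff]

theorem resfCoeff_two_mul_add_two (k : ℕ) : resfCoeff (2 * k + 2) = evenCoeff k / Real.pi := by
  rw [resfCoeff, if_pos ⟨k + 1, by lia⟩, if_neg (by lia), show (2 * k + 2) / 2 - 1 = k by lia]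

theorem resfCoeff_one : resfCoeff 1 = -(1 / 2) := by simp [resfCoeff]

theorem resfCoeff_of_odd {n : ℕ} (hn : Odd n) (h1 : n ≠ 1) : resfCoeff n = 0 := by
  rw [resfCoeff, if_neg (Nat.not_even_iff_odd.2 hn), if_neg h1]

theorem hasSum_resfCoeff {x : ℝ} (hx : x ∈ Set.Icc (-1 : ℝ) 1) :
    HasSum (fun n : ℕ => resfCoeff n * x ^ n) (resf x) := by
  have he : HasSum (fun k : ℕ => resfCoeff (2 * k) * x ^ (2 * k))
      ((√(1 - x ^ 2) + x * Real.arcsin x) / Real.pi) := by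
    rw [← hasSum_nat_add_iff' 1]
    simpa [mul_add, resfCoeff_two_mul_add_two, resfCoeff_zero, sub_div, div_mul_eq_mul_div]
      using (hasSum_evenCoeff hx).div_const Real.pi
  have ho : HasSum (fun k : ℕ => resfCoeff (2 * k + 1) * x ^ (2 * k + 1)) (-(1 / 2) * x) := by
    have h := hasSum_single (f := fun k : ℕ => resfCoeff (2 * k + 1) * x ^ (2 * k + 1)) 0
      fun k hk => by rw [resfCoeff_of_odd ⟨k, rfl⟩ (by lia), zero_mul]
    simpa only [mul_zero, zero_add, resfCoeff_one, pow_one] using h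
  have hf : resf x = (√(1 - x ^ 2) + x * Real.arcsin x) / Real.pi + -(1 / 2) * x := by
    have := Real.pi_ne_zero
    rw [resf, Real.arccos]
    field_simp
    ring
  rw [hf]
  exact HasSum.even_add_odd (f := fun n : ℕ => resfCoeff n * x ^ n) he ho

/-- `f(γ) = (1/π)(√(1-γ²) - γ arccos γ)` has an absolutely convergent power-series
expansion on `[-1,1]`, with strictly positive even coefficients, `α 1 = -1/2` and
vanishing odd coefficients of order `≥ 3`. -/
theorem stmt2 :
    ∃ α : ℕ → ℝ, Summable (fun n => |α n|) ∧
      (∀ γ ∈ Set.Icc (-1 : ℝ) 1, resf γ = ∑' n : ℕ, α n * γ ^ n) ∧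
      (∀ n, Even n → 0 < α n) ∧ α 1 = -(1 / 2) ∧
      (∀ n, Odd n → 3 ≤ n → α n = 0) := by
  refine ⟨resfCoeff, summable_abs_iff.2 ?_, fun γ hγ => (hasSum_resfCoeff hγ).tsum_eq.symm,
    fun n hn => ?_, resfCoeff_one,
    fun n hn h3 => resfCoeff_of_odd hn (by lia)⟩
  · simpa using (hasSum_resfCoeff (x := 1) (by norm_num)).summable
  · rw [resfCoeff, if_pos hn]
    have := evenCoeff_pos (n / 2 - 1)
    split_ifs <;> positivity
end

section
/- Let f : [−1,1] → ℝ be defined by f(γ) = (1/π)·(√(1−γ²) − γ·arccos γ), and let g : [−1,1] → ℝ be g(γ) = f(γ)·f′(γ), where f′(γ) = −(1/π)·arccos γ is the derivative of f. Then there exists a real sequence (β_n)_{n∈ℕ} with ∑_n |β_n| < ∞ such that g(γ) = ∑_{n≥0} β_n γ^n for all γ ∈ [−1,1], and β_n > 0 for every odd n. -/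
/-- The derivative of `resf`. -/
noncomputable def resf' (γ : ℝ) : ℝ := -(1 / Real.pi) * Real.arccos γ

/-- A power series with bounded coefficients can be differentiated termwise on `(-1, 1)`. -/
theorem hasDerivAt_tsum_mul_pow_of_bounded {c : ℕ → ℝ} {C : ℝ} (hc : ∀ n, |c n| ≤ C) {x : ℝ}
    (hx : |x| < 1) :
    HasDerivAt (fun y => ∑' n, c n * y ^ n) (∑' n : ℕ, ((n : ℝ) + 1) * c (n + 1) * x ^ n) x := by
  obtain ⟨r, hxr, hr1⟩ := exists_between hx
  have hr0 : 0 < r := (abs_nonneg x).trans_lt hxr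
  have hsum : Summable fun n : ℕ => C * ((n : ℝ) * r ^ (n - 1)) := by
    refine Summable.mul_left _ ((summable_nat_add_iff 1).1 ?_)
    have h1 : Summable fun n : ℕ => (n : ℝ) ^ 1 * r ^ n :=
      summable_pow_mul_geometric_of_norm_lt_one 1 (by rwa [Real.norm_of_nonneg hr0.le])
    refine (h1.add (summable_geometric_of_lt_one hr0.le hr1)).congr fun n => ?_
    push_cast
    ring
  have hbound : ∀ (n : ℕ) (y : ℝ), y ∈ Metric.ball (0 : ℝ) r →
      ‖c n * ((n : ℝ) * y ^ (n - 1))‖ ≤ C * ((n : ℝ) * r ^ (n - 1)) := by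
    intro n y hy
    have hy' : |y| ≤ r := by simpa using (mem_ball_zero_iff.1 hy).le
    rw [Real.norm_eq_abs, abs_mul, abs_mul, abs_pow, Nat.abs_cast]
    have hC := (abs_nonneg _).trans (hc n)
    gcongr
    exact hc n
  have hxb : x ∈ Metric.ball (0 : ℝ) r := by simpa using hxr
  have h := hasDerivAt_tsum_of_isPreconnected (g := fun n y => c n * y ^ n)
    (g' := fun n y => c n * ((n : ℝ) * y ^ (n - 1))) hsum Metric.isOpen_ball
    (convex_ball (0 : ℝ) r).isPreconnected
    (fun n y _ => (hasDerivAt_pow n y).const_mul (c n)) hbound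
    (Metric.mem_ball_self hr0)
    (summable_of_ne_finset_zero (s := {0}) fun n hn => by
      simp [zero_pow (by simpa using hn : n ≠ 0)]) hxb
  have hs : Summable fun n : ℕ => c n * ((n : ℝ) * x ^ (n - 1)) :=
    Summable.of_norm_bounded hsum fun n => hbound n x hxb
  rw [hs.tsum_eq_zero_add] at h
  refine h.congr_deriv ?_
  simp only [Nat.cast_zero, zero_mul, mul_zero, zero_add, Nat.add_sub_cancel]
  refine tsum_congr fun n => ?_
  push_cast
  ring

theorem summable_mul_pow_of_bounded {c : ℕ → ℝ} {C : ℝ} (hc : ∀ n, |c n| ≤ C) {x : ℝ}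
    (hx : |x| < 1) : Summable fun n => c n * x ^ n := by
  refine Summable.of_norm_bounded
    ((summable_geometric_of_lt_one (abs_nonneg x) hx).mul_left C) fun n => ?_
  rw [Real.norm_eq_abs, abs_mul, abs_pow]
  gcongr
  exact hc n

theorem summable_succ_mul_mul_pow_of_bounded {c : ℕ → ℝ} {C : ℝ} (hc : ∀ n, |c n| ≤ C) {x : ℝ}
    (hx : |x| < 1) : Summable fun n : ℕ => ((n : ℝ) + 1) * c n * x ^ n := by
  have h1 : Summable fun n : ℕ => (n : ℝ) ^ 1 * |x| ^ n :=
    summable_pow_mul_geometric_of_norm_lt_one 1 (by simpa using hx)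
  have h2 := (h1.add (summable_geometric_of_lt_one (abs_nonneg x) hx)).mul_left C
  refine Summable.of_norm_bounded h2 fun n => ?_
  rw [Real.norm_eq_abs, abs_mul, abs_mul, abs_pow, abs_of_nonneg (by positivity : (0 : ℝ) ≤ n + 1)]
  calc ((n : ℝ) + 1) * |c n| * |x| ^ n ≤ ((n : ℝ) + 1) * C * |x| ^ n := by gcongr; exact hc n
    _ = _ := by ring

/-- Two functions on `(-1, 1)` with the same derivative and the same value at `0` agree. -/
theorem eq_of_hasDerivAt_eq_of_abs_lt_one {f g f' : ℝ → ℝ}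
    (hf : ∀ x, |x| < 1 → HasDerivAt f (f' x) x) (hg : ∀ x, |x| < 1 → HasDerivAt g (f' x) x)
    (h0 : f 0 = g 0) {x : ℝ} (hx : |x| < 1) : f x = g x := by
  have mem : ∀ y : ℝ, y ∈ Metric.ball (0 : ℝ) 1 ↔ |y| < 1 := fun y => by simp
  refine Metric.isOpen_ball.eqOn_of_deriv_eq (convex_ball (0 : ℝ) 1).isPreconnected
    (fun y hy => (hf y ((mem y).1 hy)).differentiableAt.differentiableWithinAt)
    (fun y hy => (hg y ((mem y).1 hy)).differentiableAt.differentiableWithinAt)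
    (fun y hy => ?_) (x := 0) (by simp) h0 ((mem x).2 hx)
  rw [(hf y ((mem y).1 hy)).deriv, (hg y ((mem y).1 hy)).deriv]

/-- Taylor coefficients at `0` of `arccos x / √(1 - x ^ 2)`. -/
noncomputable def arccosDivSqrtCoeff : ℕ → ℝ
  | 0 => Real.pi / 2
  | 1 => -1
  | n + 2 => ((n : ℝ) + 1) / (n + 2) * arccosDivSqrtCoeff n

theorem sq_arccosDivSqrtCoeff_mul_le (n : ℕ) : arccosDivSqrtCoeff n ^ 2 * (n + 1) ≤ 4 := by
  induction n using Nat.twoStepInduction with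
  | zero =>
    have := Real.pi_le_four
    have := Real.pi_pos
    simp only [arccosDivSqrtCoeff]
    push_cast
    nlinarith
  | one => norm_num [arccosDivSqrtCoeff]
  | more n ih _ =>
    refine le_trans ?_ ih
    have h : ((n : ℝ) + 1) ^ 2 / (n + 2) ^ 2 * (n + 3) ≤ n + 1 := by
      rw [div_mul_eq_mul_div, div_le_iff₀ (by positivity)]
      nlinarith [(n.cast_nonneg : (0 : ℝ) ≤ n)]
    calc arccosDivSqrtCoeff (n + 2) ^ 2 * (((n + 2 : ℕ) : ℝ) + 1)
        = arccosDivSqrtCoeff n ^ 2 * (((n : ℝ) + 1) ^ 2 / (n + 2) ^ 2 * (n + 3)) := by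
          rw [arccosDivSqrtCoeff]; push_cast; field_simp; ring
      _ ≤ _ := by gcongr

theorem abs_arccosDivSqrtCoeff_le_two (n : ℕ) : |arccosDivSqrtCoeff n| ≤ 2 := by
  apply abs_le_of_sq_le_sq _ (by norm_num)
  have h := sq_arccosDivSqrtCoeff_mul_le n
  nlinarith [mul_nonneg (sq_nonneg (arccosDivSqrtCoeff n)) (n.cast_nonneg : (0 : ℝ) ≤ n)]

theorem arccosDivSqrtCoeff_neg_of_odd {n : ℕ} (hn : Odd n) : arccosDivSqrtCoeff n < 0 := by
  obtain ⟨k, rfl⟩ := hn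
  induction k with
  | zero => norm_num [arccosDivSqrtCoeff]
  | succ k ih =>
    rw [show 2 * (k + 1) + 1 = 2 * k + 1 + 2 by ring, arccosDivSqrtCoeff]
    exact mul_neg_of_pos_of_neg (by positivity) ih

/-- The sum of the power series with coefficients `arccosDivSqrtCoeff`. -/
noncomputable def arccosDivSqrtSeries (x : ℝ) : ℝ := ∑' n, arccosDivSqrtCoeff n * x ^ n

theorem arccosDivSqrtSeries_zero : arccosDivSqrtSeries 0 = Real.pi / 2 := by
  rw [arccosDivSqrtSeries, tsum_eq_single 0 fun n hn => by simp [zero_pow hn]]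
  simp [arccosDivSqrtCoeff]

/-- The series solves `(1 - x ^ 2) * y' = x * y - 1`. -/
theorem hasDerivAt_arccosDivSqrtSeries {x : ℝ} (hx : |x| < 1) :
    HasDerivAt arccosDivSqrtSeries ((x * arccosDivSqrtSeries x - 1) / (1 - x ^ 2)) x := by
  have hpos : 0 < 1 - x ^ 2 := by have := (sq_lt_one_iff_abs_lt_one x).2 hx; linarith
  have hb := abs_arccosDivSqrtCoeff_le_two
  have hs := summable_mul_pow_of_bounded hb hx
  have hs1 := summable_succ_mul_mul_pow_of_bounded hb hx
  have hs2 : Summable fun n : ℕ => ((n : ℝ) + 1) * arccosDivSqrtCoeff (n + 1) * x ^ n :=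
    (summable_succ_mul_mul_pow_of_bounded (c := fun n => arccosDivSqrtCoeff (n + 1))
      (fun n => hb (n + 1)) hx)
  have hd := hasDerivAt_tsum_mul_pow_of_bounded hb hx
  refine (hd).congr_deriv
      (Eq.symm ?_)
  set D := ∑' n : ℕ, ((n : ℝ) + 1) * arccosDivSqrtCoeff (n + 1) * x ^ n with hD
  have e1 : D = -1 + x * ∑' n : ℕ, ((n : ℝ) + 1) * arccosDivSqrtCoeff n * x ^ n := by
    rw [hD, hs2.tsum_eq_zero_add, ← tsum_mul_left]
    congr 1
    · simp [arccosDivSqrtCoeff]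
    · refine tsum_congr fun n => ?_
      rw [arccosDivSqrtCoeff]
      push_cast
      field_simp
      ring
  have e2 : ∑' n : ℕ, ((n : ℝ) + 1) * arccosDivSqrtCoeff n * x ^ n
      = arccosDivSqrtSeries x + x * D := by
    have hs3 : Summable fun n : ℕ => (n : ℝ) * arccosDivSqrtCoeff n * x ^ n :=
      (hs1.sub hs).congr fun n => by ring
    have e3 : ∑' n : ℕ, (n : ℝ) * arccosDivSqrtCoeff n * x ^ n = x * D := by
      rw [hs3.tsum_eq_zero_add, hD, ← tsum_mul_left]
      simp only [Nat.cast_zero, zero_mul, zero_add]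
      refine tsum_congr fun n => ?_
      push_cast
      ring
    rw [← e3, arccosDivSqrtSeries, ← hs.tsum_add hs3]
    exact tsum_congr fun n => by ring
  rw [e2] at e1
  rw [div_eq_iff hpos.ne']
  linarith

theorem hasDerivAt_sqrt_one_sub_sq {x : ℝ} (hx : |x| < 1) :
    HasDerivAt (fun y : ℝ => √(1 - y ^ 2)) (-x / √(1 - x ^ 2)) x := by
  have hpos : 0 < 1 - x ^ 2 := by have := (sq_lt_one_iff_abs_lt_one x).2 hx; linarith
  refine ((((hasDerivAt_pow 2 x).const_sub 1).sqrt hpos.ne')).congr_deriv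
      (Eq.symm ?_)
  have := (Real.sqrt_pos.2 hpos).ne'
  field_simp
  norm_num [mul_comm]

theorem hasDerivAt_arccos_of_abs_lt_one {x : ℝ} (hx : |x| < 1) :
    HasDerivAt Real.arccos (-(1 / √(1 - x ^ 2))) x :=
  Real.hasDerivAt_arccos (abs_lt.1 hx).1.ne' (abs_lt.1 hx).2.ne

theorem arccos_eq_sqrt_mul_series {x : ℝ} (hx : |x| < 1) :
    Real.arccos x = √(1 - x ^ 2) * arccosDivSqrtSeries x := by
  refine eq_of_hasDerivAt_eq_of_abs_lt_one (f := Real.arccos)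
    (g := fun x => √(1 - x ^ 2) * arccosDivSqrtSeries x)
    (f' := fun x => -(1 / √(1 - x ^ 2)))
    (fun y hy => hasDerivAt_arccos_of_abs_lt_one hy) (fun y hy => ?_)
    (by simp [arccosDivSqrtSeries_zero]) hx
  have hpos : 0 < 1 - y ^ 2 := by have := (sq_lt_one_iff_abs_lt_one y).2 hy; linarith
  refine ((hasDerivAt_sqrt_one_sub_sq hy).mul (hasDerivAt_arccosDivSqrtSeries hy)).congr_deriv
      (Eq.symm ?_)
  have h1 := (Real.sqrt_pos.2 hpos).ne'
  have h2 := Real.sq_sqrt hpos.le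
  have h3 : 1 - y ^ 2 = √(1 - y ^ 2) * √(1 - y ^ 2) := by rw [← sq, h2]
  generalize √(1 - y ^ 2) = s at *
  rw [h3]
  field_simp
  ring

/-- Taylor coefficients at `0` of `arccos x ^ 2`. -/
noncomputable def sqArccosCoeff : ℕ → ℝ
  | 0 => Real.pi ^ 2 / 4
  | n + 1 => -2 * arccosDivSqrtCoeff n / (n + 1)

theorem abs_sqArccosCoeff_le_four (n : ℕ) : |sqArccosCoeff n| ≤ 4 := by
  cases n with
  | zero =>
    have := Real.pi_le_four
    have := Real.pi_pos
    rw [sqArccosCoeff, abs_of_nonneg (by positivity)]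
    nlinarith
  | succ n =>
    have h := abs_arccosDivSqrtCoeff_le_two n
    rw [sqArccosCoeff, abs_div, abs_mul, abs_of_nonneg (by positivity : (0 : ℝ) ≤ n + 1),
      div_le_iff₀ (by positivity)]
    norm_num
    nlinarith [(n.cast_nonneg : (0 : ℝ) ≤ n)]

theorem sq_arccos_eq_tsum {x : ℝ} (hx : |x| < 1) :
    Real.arccos x ^ 2 = ∑' n, sqArccosCoeff n * x ^ n := by
  refine eq_of_hasDerivAt_eq_of_abs_lt_one (f := fun x => Real.arccos x ^ 2)
    (g := fun x => ∑' n, sqArccosCoeff n * x ^ n)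
    (f' := fun x => -2 * arccosDivSqrtSeries x) (fun y hy => ?_) (fun y hy => ?_) ?_ hx
  · have hpos : 0 < 1 - y ^ 2 := by have := (sq_lt_one_iff_abs_lt_one y).2 hy; linarith
    have h1 := (Real.sqrt_pos.2 hpos).ne'
    refine ((hasDerivAt_arccos_of_abs_lt_one hy).pow 2).congr_deriv
      (Eq.symm ?_)
    rw [arccos_eq_sqrt_mul_series hy]
    field_simp
    norm_num [mul_assoc]
  · refine (hasDerivAt_tsum_mul_pow_of_bounded abs_sqArccosCoeff_le_four hy).congr_deriv
      (Eq.symm ?_)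
    rw [arccosDivSqrtSeries, ← tsum_mul_left]
    refine tsum_congr fun n => ?_
    rw [sqArccosCoeff]
    field_simp
  · rw [tsum_eq_single 0 fun n hn => by simp [zero_pow hn]]
    simp [sqArccosCoeff]
    ring

/-- Taylor coefficients at `0` of `√(1 - x ^ 2) * arccos x - x * arccos x ^ 2`. -/
noncomputable def resfMulDerivCoeff : ℕ → ℝ
  | 0 => Real.pi / 2
  | 1 => -1 - Real.pi ^ 2 / 4
  | n + 2 => arccosDivSqrtCoeff n * ((n + 3) / ((n + 1) * (n + 2)))

theorem summable_abs_resfMulDerivCoeff : Summable fun n => |resfMulDerivCoeff n| := by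
  refine (summable_nat_add_iff 2).1 ?_
  have hs : Summable fun n : ℕ => 4 * (1 / ((n + 1 : ℕ) : ℝ) ^ (3 / 2 : ℝ)) :=
    ((summable_nat_add_iff 1).2 (Real.summable_one_div_nat_rpow.2 (by norm_num))).mul_left 4
  refine Summable.of_nonneg_of_le (fun n => abs_nonneg _) (fun n => ?_) hs
  have hn : (0 : ℝ) < n + 1 := by positivity
  have hq : ((n : ℝ) + 1) ^ (3 / 2 : ℝ) = (n + 1) * √(n + 1) := by
    rw [Real.sqrt_eq_rpow, ← Real.rpow_one_add' hn.le (by norm_num)]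
    norm_num
  have hsq := Real.sqrt_pos.2 hn
  have hv : |arccosDivSqrtCoeff n| * √(n + 1) ≤ 2 := by
    refine le_of_sq_le_sq ?_ (by norm_num)
    rw [mul_pow, sq_abs, Real.sq_sqrt hn.le]
    linarith [sq_arccosDivSqrtCoeff_mul_le n]
  push_cast
  rw [resfMulDerivCoeff, hq, abs_mul,
    abs_of_nonneg (by positivity : (0 : ℝ) ≤ (n + 3) / ((n + 1) * (n + 2)))]
  rw [mul_one_div, le_div_iff₀ (by positivity)]
  calc _ = (|arccosDivSqrtCoeff n| * √(n + 1)) * ((n + 3) / (n + 2)) := by field_simp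
    _ ≤ 2 * 2 := by
      gcongr
      rw [div_le_iff₀ (by positivity)]
      linarith
    _ = 4 := by norm_num

theorem exists_abs_resfMulDerivCoeff_le : ∃ C, ∀ n, |resfMulDerivCoeff n| ≤ C :=
  ⟨_, fun n => summable_abs_resfMulDerivCoeff.le_tsum n fun _ _ => abs_nonneg _⟩

theorem sqrt_mul_arccos_sub_eq_tsum_of_abs_lt_one {x : ℝ} (hx : |x| < 1) :
    √(1 - x ^ 2) * Real.arccos x - x * Real.arccos x ^ 2
      = ∑' n, resfMulDerivCoeff n * x ^ n := by
  obtain ⟨C, hC⟩ := exists_abs_resfMulDerivCoeff_le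
  refine eq_of_hasDerivAt_eq_of_abs_lt_one
    (f := fun x => √(1 - x ^ 2) * Real.arccos x - x * Real.arccos x ^ 2)
    (g := fun x => ∑' n, resfMulDerivCoeff n * x ^ n)
    (f' := fun x => x * arccosDivSqrtSeries x - 1 - Real.arccos x ^ 2)
    (fun y hy => ?_) (fun y hy => ?_) ?_ hx
  · have hpos : 0 < 1 - y ^ 2 := by have := (sq_lt_one_iff_abs_lt_one y).2 hy; linarith
    have h1 := (Real.sqrt_pos.2 hpos).ne'
    have ha := hasDerivAt_arccos_of_abs_lt_one hy
    refine (((hasDerivAt_sqrt_one_sub_sq hy).mul ha).sub ((hasDerivAt_id y).mul (ha.pow 2))).congr_deriv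
      (Eq.symm ?_)
    simp only [id_eq, Pi.pow_apply]
    rw [arccos_eq_sqrt_mul_series hy]
    field_simp
    ring
  · refine (hasDerivAt_tsum_mul_pow_of_bounded hC hy).congr_deriv
      (Eq.symm ?_)
    have hs := summable_mul_pow_of_bounded abs_arccosDivSqrtCoeff_le_two hy
    have hq := summable_mul_pow_of_bounded abs_sqArccosCoeff_le_four hy
    have hq' := (summable_nat_add_iff 1).2 hq
    have hr : Summable fun n : ℕ => ((n : ℝ) + 1) * resfMulDerivCoeff (n + 1) * y ^ n :=
      summable_succ_mul_mul_pow_of_bounded (c := fun n => resfMulDerivCoeff (n + 1))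
        (fun n => hC (n + 1)) hy
    rw [sq_arccos_eq_tsum hy, hr.tsum_eq_zero_add, hq.tsum_eq_zero_add, arccosDivSqrtSeries,
      ← tsum_mul_left]
    have key : ∑' n : ℕ, (((n + 1 : ℕ) : ℝ) + 1) * resfMulDerivCoeff (n + 1 + 1) * y ^ (n + 1)
        = ∑' n : ℕ, y * (arccosDivSqrtCoeff n * y ^ n)
          - ∑' n : ℕ, sqArccosCoeff (n + 1) * y ^ (n + 1) := by
      rw [← (hs.mul_left y).tsum_sub hq']
      refine tsum_congr fun n => ?_
      rw [resfMulDerivCoeff, sqArccosCoeff]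
      push_cast
      field_simp
      ring
    rw [key]
    simp [sqArccosCoeff, resfMulDerivCoeff]
    ring
  · rw [tsum_eq_single 0 fun n hn => by simp [zero_pow hn]]
    simp [resfMulDerivCoeff]

theorem sqrt_mul_arccos_sub_eq_tsum {x : ℝ} (hx : x ∈ Set.Icc (-1 : ℝ) 1) :
    √(1 - x ^ 2) * Real.arccos x - x * Real.arccos x ^ 2
      = ∑' n, resfMulDerivCoeff n * x ^ n := by
  have hcl : closure (Set.Ioo (-1 : ℝ) 1) = Set.Icc (-1) 1 := closure_Ioo (by norm_num)
  refine Set.EqOn.of_subset_closure (s := Set.Ioo (-1 : ℝ) 1) (t := Set.Icc (-1 : ℝ) 1)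
    (f := fun x => √(1 - x ^ 2) * Real.arccos x - x * Real.arccos x ^ 2)
    (g := fun x => ∑' n, resfMulDerivCoeff n * x ^ n)
    (fun y hy => sqrt_mul_arccos_sub_eq_tsum_of_abs_lt_one (abs_lt.2 hy)) ?_ ?_
    Set.Ioo_subset_Icc_self hcl.ge hx
  · have := Real.continuous_arccos
    fun_prop
  · refine continuousOn_tsum (fun n => by fun_prop) summable_abs_resfMulDerivCoeff fun n y hy => ?_
    rw [Real.norm_eq_abs, abs_mul, abs_pow]
    exact mul_le_of_le_one_right (abs_nonneg _) (pow_le_one₀ (abs_nonneg _) (abs_le.2 hy))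

theorem resfMulDerivCoeff_neg_of_odd {n : ℕ} (hn : Odd n) : resfMulDerivCoeff n < 0 := by
  match n, hn with
  | 0, hn => simp at hn
  | 1, _ =>
    rw [resfMulDerivCoeff]
    nlinarith [sq_nonneg Real.pi]
  | n + 2, hn =>
    rw [resfMulDerivCoeff]
    have h : Odd n := by simpa [Nat.odd_add, parity_simps] using hn
    exact mul_neg_of_neg_of_pos (arccosDivSqrtCoeff_neg_of_odd h) (by positivity)

/-- `g = f·f′` has an absolutely convergent power-series expansion on `[-1,1]` with
strictly positive odd coefficients. -/
theorem stmt3 :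
    ∃ β : ℕ → ℝ, Summable (fun n => |β n|) ∧
      (∀ γ ∈ Set.Icc (-1 : ℝ) 1, resf γ * resf' γ = ∑' n : ℕ, β n * γ ^ n) ∧
      (∀ n, Odd n → 0 < β n) := by
  refine ⟨fun n => -(1 / Real.pi ^ 2) * resfMulDerivCoeff n, ?_, fun γ hγ => ?_, fun n hn => ?_⟩
  · simp only [abs_mul]
    exact summable_abs_resfMulDerivCoeff.mul_left _
  · simp only [mul_assoc]
    rw [tsum_mul_left, ← sqrt_mul_arccos_sub_eq_tsum hγ, resf, resf']
    ring
  · have := Real.pi_pos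
    exact mul_pos_of_neg_of_neg (neg_neg_of_pos (by positivity)) (resfMulDerivCoeff_neg_of_odd hn)
end

section
/- Let H be a separable real Hilbert space and (A_n)_{n∈ℕ} a family of compact, self-adjoint, nonnegative operators on H. Let R_n denote the range of A_n, and assume the linear span of ⋃_n R_n is dense in H. Let (α_n)_{n∈ℕ} be strictly positive reals such that A = ∑_{n∈ℕ} α_n A_n converges in operator norm. Then A is a compact self-adjoint operator that is strictly positive definite: ⟨A h, h⟩ > 0 for every nonzero h ∈ H. -/
open RealInnerProductSpace

/-- A nonnegative symmetric operator vanishes wherever its quadratic form does. -/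
theorem apply_eq_zero_of_inner_self_eq_zero {H : Type*} [NormedAddCommGroup H]
    [InnerProductSpace ℝ H] {B : H →ₗ[ℝ] H} (hB : B.IsSymmetric)
    (hnn : ∀ x, 0 ≤ ⟪B x, x⟫) {x : H} (hx : ⟪B x, x⟫ = 0) : B x = 0 := by
  have key : ∀ t : ℝ, 0 ≤ ⟪B (B x), B x⟫ * (t * t) + 2 * ⟪B x, B x⟫ * t + 0 := fun t => by
    have h := hnn (x + t • B x)
    simp only [map_add, map_smul, inner_add_left, inner_add_right, real_inner_smul_left,
      real_inner_smul_right, hx, hB (B x) x] at h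
    linarith
  have hd := discrim_le_zero key
  simp only [discrim, mul_zero, sub_zero] at hd
  have h0 := pow_eq_zero_iff two_ne_zero |>.1 (le_antisymm hd (sq_nonneg _))
  exact inner_self_eq_zero.1 (by linarith : ⟪B x, B x⟫ = 0)

/-- A convergent series `A = ∑ α_n A_n` of compact, self-adjoint, nonnegative operators
with strictly positive coefficients, whose ranges have dense linear span, is a compact
self-adjoint strictly positive definite operator. -/
theorem stmt10 (H : Type*) [NormedAddCommGroup H] [InnerProductSpace ℝ H]
    [CompleteSpace H] [TopologicalSpace.SeparableSpace H]
    (A : ℕ → H →L[ℝ] H)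
    (hcpt : ∀ n, IsCompactOperator (A n))
    (hsa : ∀ n, ∀ x y : H, ⟪A n x, y⟫ = ⟪x, A n y⟫)
    (hnn : ∀ n, ∀ x : H, 0 ≤ ⟪A n x, x⟫)
    (hdense : Dense
      (↑(Submodule.span ℝ (⋃ n : ℕ, Set.range (A n))) : Set H))
    (α : ℕ → ℝ) (hα : ∀ n, 0 < α n)
    (T : H →L[ℝ] H)
    (hconv : Filter.Tendsto (fun N => ∑ n ∈ Finset.range N, α n • A n)
      Filter.atTop (nhds T)) :
    IsCompactOperator T ∧ (∀ x y : H, ⟪T x, y⟫ = ⟪x, T y⟫) ∧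
      ∀ h : H, h ≠ 0 → 0 < ⟪T h, h⟫ := by
  have hlim : ∀ x y : H, Filter.Tendsto
      (fun N => ∑ n ∈ Finset.range N, α n * ⟪A n x, y⟫) Filter.atTop (nhds ⟪T x, y⟫) := by
    intro x y
    have h := ((ContinuousLinearMap.apply ℝ H x).continuous.tendsto T).comp hconv
    simpa [Function.comp_def, sum_inner, real_inner_smul_left] using
      h.inner (𝕜 := ℝ) (tendsto_const_nhds (x := y))
  refine ⟨?_, ?_, ?_⟩
  · refine isCompactOperator_of_tendsto hconv (Filter.Eventually.of_forall fun N => ?_)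
    exact Submodule.sum_mem (compactOperator (RingHom.id ℝ) H H)
      (fun n _ => (hcpt n).smul (α n))
  · intro x y
    refine tendsto_nhds_unique (hlim x y) ?_
    simpa only [hsa _ x y, real_inner_comm] using hlim y x
  · intro h hh
    obtain ⟨n, hn⟩ : ∃ n, A n h ≠ 0 := by
      by_contra! hzero
      refine hh (hdense.eq_zero_of_inner_left ℝ fun v hv => ?_)
      induction hv using Submodule.span_induction with
      | mem v hv =>
        obtain ⟨n, w, rfl⟩ := Set.mem_iUnion.1 hv
        rw [← hsa, hzero, inner_zero_left]
      | zero => exact inner_zero_right h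
      | add v w _ _ hv hw => rw [inner_add_right, hv, hw, add_zero]
      | smul c v _ hv => rw [real_inner_smul_right, hv, mul_zero]
    have hpos : 0 < ⟪A n h, h⟫ := (hnn n h).lt_of_ne' fun h0 =>
      hn (apply_eq_zero_of_inner_self_eq_zero (B := (A n : H →ₗ[ℝ] H)) (hsa n) (hnn n) h0)
    refine (mul_pos (hα n) hpos).trans_le (ge_of_tendsto (hlim h h) ?_)
    filter_upwards [Filter.eventually_gt_atTop n] with N hN
    exact Finset.single_le_sum (f := fun k => α k * ⟪A k h, h⟫)
      (fun k _ => mul_nonneg (hα k).le (hnn k h)) (Finset.mem_range.2 hN)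
end
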